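/- (Funk–Hecke type formula) Let m ≥ 3, l ∈ ℕ, and let h be a continuous function on [-1,1]. Let p : ℝ^m → ℝ be a harmonic polynomial homogeneous of degree l. Then for every ω ∈ S^{m-1}, ∫_{S^{m-1}} h(⟨ω, ω'⟩)·p(ω') dω' = c_{l,m}(h)·p(ω), where c_{l,m}(h) := (2^{m-2}·π^{(m-2)/2}·l!/Γ(m-2+l))·∫_0^π h(cos θ)·C̃_l^{(m-2)/2}(cos θ)·sin^{m-2}θ dθ and dω' is the (unnormalized) surface measure on the unit sphere S^{m-1} ⊂ ℝ^m. -/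

import Mathlib

open MeasureTheory
open scoped RealInnerProductSpace

/-- The Gegenbauer polynomial `C_l^μ(x)` given by the Rodrigues formula. -/
noncomputable def gegenC (μ : ℝ) (l : ℕ) (x : ℝ) : ℝ :=
  (-1/2 : ℝ) ^ l *
    ((ascPochhammer ℝ l).eval (2 * μ) /
      ((Nat.factorial l : ℝ) * (ascPochhammer ℝ l).eval (μ + 1/2))) *
    (1 - x ^ 2) ^ (-μ + 1/2) *
    iteratedDeriv l (fun y : ℝ => (1 - y ^ 2) ^ ((l : ℝ) + μ - 1/2)) x

/-- The normalized Gegenbauer polynomial `C̃_l^μ(x) = Γ(μ)·C_l^μ(x)`. -/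
noncomputable def gegenTilde (μ : ℝ) (l : ℕ) (x : ℝ) : ℝ :=
  Real.Gamma μ * gegenC μ l x

/-- The Funk–Hecke coefficient
`c_{l,m}(h) = (2^{m-2}·π^{(m-2)/2}·l!/Γ(m-2+l))·∫_0^π h(cosθ)·C̃_l^{(m-2)/2}(cosθ)·sin^{m-2}θ dθ`. -/
noncomputable def funkHeckeCoeff (m l : ℕ) (h : ℝ → ℝ) : ℝ :=
  (2 ^ (m - 2) * Real.pi ^ (((m : ℝ) - 2) / 2) * (Nat.factorial l : ℝ) /
      Real.Gamma ((m : ℝ) - 2 + l)) *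
    ∫ θ in (0:ℝ)..Real.pi,
      h (Real.cos θ) * gegenTilde (((m : ℝ) - 2) / 2) l (Real.cos θ) *
        Real.sin θ ^ (m - 2)

/-! ### Gaussian moments -/

/-- One-dimensional Gaussian moments. -/
noncomputable def gmom (n : ℕ) : ℝ := ∫ x : ℝ, x ^ n * Real.exp (-x ^ 2)

lemma gmom_integrable (n : ℕ) : Integrable (fun x : ℝ => x ^ n * Real.exp (-x ^ 2)) := by
  have := integrable_rpow_mul_exp_neg_mul_sq (b := 1) one_pos (s := n)
    (by have : (0:ℝ) ≤ n := Nat.cast_nonneg n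
        linarith)
  simpa using this

lemma gmom_zero : gmom 0 = Real.sqrt Real.pi := by
  have := integral_gaussian 1
  simpa [gmom] using this

lemma gmom_succ (n : ℕ) : gmom (n + 1) = n / 2 * gmom (n - 1) := by
  have h := integral_eq_zero_of_hasDerivAt_of_integrable
    (f := fun x : ℝ => x ^ n * Real.exp (-x ^ 2))
    (f' := fun x : ℝ => n * (x ^ (n - 1) * Real.exp (-x ^ 2))
      - 2 * (x ^ (n + 1) * Real.exp (-x ^ 2)))
    (fun x => by
      have h1 := (hasDerivAt_pow n x).fun_mul ((hasDerivAt_pow 2 x).fun_neg.exp)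
      refine h1.congr_deriv ?_
      push_cast
      ring)
    (((gmom_integrable (n - 1)).const_mul _).sub ((gmom_integrable (n + 1)).const_mul _))
    (gmom_integrable n)
  rw [integral_sub ((gmom_integrable (n - 1)).const_mul _)
    ((gmom_integrable (n + 1)).const_mul _), integral_const_mul, integral_const_mul] at h
  unfold gmom
  linarith

/-- The Gaussian functional on polynomials. -/
noncomputable def gaussL {m : ℕ} (Q : MvPolynomial (Fin m) ℝ) : ℝ :=
  ∫ x : EuclideanSpace ℝ (Fin m), MvPolynomial.eval (fun i => x i) Q * Real.exp (-‖x‖ ^ 2)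

lemma gauss_monomial_eq {m : ℕ} (a : Fin m →₀ ℕ) (c : ℝ) (x : EuclideanSpace ℝ (Fin m)) :
    MvPolynomial.eval (fun i => x i) (MvPolynomial.monomial a c) * Real.exp (-‖x‖ ^ 2) =
      c * ∏ i, (fun y : ℝ => y ^ a i * Real.exp (-y ^ 2)) (x.ofLp i) := by
  rw [MvPolynomial.eval_monomial, Finsupp.prod_fintype _ _ (by simp), EuclideanSpace.norm_sq_eq,
    ← Finset.sum_neg_distrib, Real.exp_sum, Finset.prod_mul_distrib, mul_assoc]
  simp

lemma gauss_monomial_integrable {m : ℕ} (a : Fin m →₀ ℕ) (c : ℝ) :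
    Integrable (fun x : EuclideanSpace ℝ (Fin m) =>
      MvPolynomial.eval (fun i => x i) (MvPolynomial.monomial a c) * Real.exp (-‖x‖ ^ 2)) := by
  simp_rw [gauss_monomial_eq]
  have h := MeasureTheory.Integrable.fintype_prod (μ := fun _ : Fin m => (volume : Measure ℝ))
    (f := fun (i : Fin m) (y : ℝ) => y ^ a i * Real.exp (-y ^ 2)) (fun i => gmom_integrable (a i))
  have h2 := (EuclideanSpace.volume_preserving_symm_measurableEquiv_toLp (Fin m)).integrable_comp_emb
    (MeasurableEquiv.measurableEmbedding _) (g := fun y : Fin m → ℝ =>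
      ∏ i, (fun y : ℝ => y ^ a i * Real.exp (-y ^ 2)) (y i))
  exact (h2.2 h).const_mul c

lemma gaussL_monomial {m : ℕ} (a : Fin m →₀ ℕ) (c : ℝ) :
    gaussL (MvPolynomial.monomial a c) = c * ∏ i, gmom (a i) := by
  unfold gaussL
  simp_rw [gauss_monomial_eq]
  rw [integral_const_mul]
  have h2 := (EuclideanSpace.volume_preserving_symm_measurableEquiv_toLp (Fin m)).integral_comp
    (MeasurableEquiv.measurableEmbedding _) (fun y : Fin m → ℝ =>
      ∏ i, (fun y : ℝ => y ^ a i * Real.exp (-y ^ 2)) (y i))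
  rw [integral_fintype_prod_volume_eq_prod (fun (i : Fin m) (y : ℝ) => y ^ a i * Real.exp (-y ^ 2))] at h2
  unfold gmom
  rw [← h2]
  rfl

lemma gauss_integrable {m : ℕ} (Q : MvPolynomial (Fin m) ℝ) :
    Integrable (fun x : EuclideanSpace ℝ (Fin m) =>
      MvPolynomial.eval (fun i => x i) Q * Real.exp (-‖x‖ ^ 2)) := by
  induction Q using MvPolynomial.induction_on' with
  | monomial a c => exact gauss_monomial_integrable a c
  | add p q hp hq =>
    refine (hp.add hq).congr (Filter.Eventually.of_forall fun x => ?_)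
    simp [add_mul]

lemma gaussL_add {m : ℕ} (p q : MvPolynomial (Fin m) ℝ) :
    gaussL (p + q) = gaussL p + gaussL q := by
  unfold gaussL
  rw [← integral_add (gauss_integrable p) (gauss_integrable q)]
  simp [add_mul]

lemma gaussL_C_mul {m : ℕ} (c : ℝ) (q : MvPolynomial (Fin m) ℝ) :
    gaussL (MvPolynomial.C c * q) = c * gaussL q := by
  unfold gaussL
  rw [← integral_const_mul]
  simp [mul_assoc]

lemma gaussL_zero {m : ℕ} : gaussL (0 : MvPolynomial (Fin m) ℝ) = 0 := by
  simp [gaussL]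

lemma gaussL_sum {m : ℕ} {ι : Type*} (s : Finset ι) (f : ι → MvPolynomial (Fin m) ℝ) :
    gaussL (∑ i ∈ s, f i) = ∑ i ∈ s, gaussL (f i) := by
  classical
  induction s using Finset.induction_on with
  | empty => simp [gaussL_zero]
  | insert a s ha ih => rw [Finset.sum_insert ha, Finset.sum_insert ha, gaussL_add, ih]

lemma gaussL_X_mul {m : ℕ} (i : Fin m) (Q : MvPolynomial (Fin m) ℝ) :
    gaussL (MvPolynomial.X i * Q) = 1 / 2 * gaussL (MvPolynomial.pderiv i Q) := by
  induction Q using MvPolynomial.induction_on' with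
  | monomial a c =>
    rw [MvPolynomial.pderiv_monomial, MvPolynomial.X, MvPolynomial.monomial_mul,
      gaussL_monomial, gaussL_monomial, ← Finset.mul_prod_erase _ _ (Finset.mem_univ i),
      ← Finset.mul_prod_erase _ (fun j => gmom ((a - Finsupp.single i 1 : Fin m →₀ ℕ) j)) (Finset.mem_univ i)]
    have h1 : ∀ j ∈ Finset.univ.erase i, gmom ((Finsupp.single i 1 + a : Fin m →₀ ℕ) j) = gmom (a j) := by
      intro j hj
      have : i ≠ j := (Finset.ne_of_mem_erase hj).symm
      simp [this]
    have h2 : ∀ j ∈ Finset.univ.erase i, gmom ((a - Finsupp.single i 1 : Fin m →₀ ℕ) j) = gmom (a j) := by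
      intro j hj
      have : i ≠ j := (Finset.ne_of_mem_erase hj).symm
      simp [this]
    rw [Finset.prod_congr rfl h1, Finset.prod_congr rfl h2]
    have h3 : (Finsupp.single i 1 + a : Fin m →₀ ℕ) i = a i + 1 := by simp [add_comm]
    have h4 : (a - Finsupp.single i 1 : Fin m →₀ ℕ) i = a i - 1 := by simp
    rw [h3, h4, gmom_succ]
    ring
  | add p q hp hq =>
    rw [mul_add, gaussL_add, hp, hq, map_add, gaussL_add]
    ring

lemma gaussL_one {m : ℕ} : gaussL (1 : MvPolynomial (Fin m) ℝ) = Real.sqrt Real.pi ^ m := by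
  have := gaussL_monomial (m := m) 0 1
  rw [show (MvPolynomial.monomial 0 1 : MvPolynomial (Fin m) ℝ) = 1 from rfl] at this
  rw [this]
  simp [gmom_zero]

/-! ### Polar coordinates -/

/-- The sphere integral of a polynomial. -/
noncomputable def sphI {m : ℕ} (Q : MvPolynomial (Fin m) ℝ) : ℝ :=
  ∫ w : Metric.sphere (0 : EuclideanSpace ℝ (Fin m)) 1,
    MvPolynomial.eval (fun i => (w : EuclideanSpace ℝ (Fin m)) i) Q
    ∂((volume : Measure (EuclideanSpace ℝ (Fin m))).toSphere)

lemma hom_eval {m d : ℕ} {Q : MvPolynomial (Fin m) ℝ} (hQ : Q.IsHomogeneous d) (r : ℝ)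
    (x : Fin m → ℝ) :
    MvPolynomial.eval (fun i => r * x i) Q = r ^ d * MvPolynomial.eval x Q := by
  rw [MvPolynomial.eval_eq', MvPolynomial.eval_eq', Finset.mul_sum]
  refine Finset.sum_congr rfl fun a ha => ?_
  have h1 : ∑ i, a i = d := by
    have := hQ (MvPolynomial.mem_support_iff.1 ha)
    rw [← this, Finsupp.weight_apply, Finsupp.sum_fintype _ _ (by simp)]
    simp
  simp_rw [mul_pow, Finset.prod_mul_distrib, Finset.prod_pow_eq_pow_sum, h1]
  ring

lemma radial_integral (d n : ℕ) :
    ∫ r : Set.Ioi (0 : ℝ), (r : ℝ) ^ d * Real.exp (-(r : ℝ) ^ 2) ∂(Measure.volumeIoiPow n) =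
      Real.Gamma (((d : ℝ) + n + 1) / 2) / 2 := by
  simp only [Measure.volumeIoiPow, ENNReal.ofReal]
  rw [integral_withDensity_eq_integral_smul,
        integral_subtype_comap measurableSet_Ioi fun a : ℝ ↦
          Real.toNNReal (a ^ n) • (a ^ d * Real.exp (-a ^ 2))]
  · have h := integral_rpow_mul_exp_neg_rpow (p := 2) (q := ((d + n : ℕ) : ℝ)) two_pos
      (by have : (0:ℝ) ≤ ((d + n : ℕ) : ℝ) := Nat.cast_nonneg _
          linarith)
    push_cast at h
    rw [div_eq_inv_mul _ (2:ℝ), ← one_div, ← h]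
    refine setIntegral_congr_fun measurableSet_Ioi fun x hx => ?_
    have hx' : (0:ℝ) < x := hx
    simp only [NNReal.smul_def]
    rw [Real.coe_toNNReal _ (pow_nonneg hx'.le _), smul_eq_mul, ← Nat.cast_add, Real.rpow_natCast,
      pow_add, Real.rpow_two]
    ring
  · exact (measurable_subtype_coe.pow_const _).real_toNNReal

lemma gaussL_polar {m d : ℕ} (hm : 1 ≤ m) {Q : MvPolynomial (Fin m) ℝ} (hQ : Q.IsHomogeneous d) :
    gaussL Q = Real.Gamma (((d : ℝ) + m) / 2) / 2 * sphI Q := by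
  let μ : Measure (EuclideanSpace ℝ (Fin m)) := volume
  let f : EuclideanSpace ℝ (Fin m) → ℝ :=
    fun x => MvPolynomial.eval (fun i => x i) Q * Real.exp (-‖x‖ ^ 2)
  have : Nonempty (Fin m) := ⟨⟨0, hm⟩⟩
  have e1 : gaussL Q = ∫ x : ({(0)}ᶜ : Set (EuclideanSpace ℝ (Fin m))), f x.1 ∂(μ.comap (↑)) := by
    rw [integral_subtype_comap (measurableSet_singleton _).compl f,
        restrict_compl_singleton]
    rfl
  let g : Metric.sphere (0 : EuclideanSpace ℝ (Fin m)) 1 × Set.Ioi (0 : ℝ) → ℝ := fun z =>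
    MvPolynomial.eval (fun i => (z.1 : EuclideanSpace ℝ (Fin m)) i) Q *
      ((z.2 : ℝ) ^ d * Real.exp (-(z.2 : ℝ) ^ 2))
  have e2 := μ.measurePreserving_homeomorphUnitSphereProd.integral_comp
        (Homeomorph.measurableEmbedding _) g
  have e3 : ∀ x : ({(0)}ᶜ : Set (EuclideanSpace ℝ (Fin m))),
      g (homeomorphUnitSphereProd _ x) = f x.1 := by
    intro x
    have hx : ‖x.1‖ ≠ 0 := by
      exact norm_ne_zero_iff.2 x.2
    simp only [g, f, homeomorphUnitSphereProd_apply_snd_coe, homeomorphUnitSphereProd_apply_fst_coe]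
    have := hom_eval hQ ‖x.1‖ (fun i => (‖x.1‖⁻¹ • x.1) i)
    have h2 : (fun i => ‖x.1‖ * (‖x.1‖⁻¹ • x.1) i) = fun i => x.1 i := by
      ext i
      simp [hx]
    rw [h2] at this
    rw [this]
    ring
  simp_rw [e3] at e2
  rw [e1, e2, integral_prod_mul
    (fun w : Metric.sphere (0 : EuclideanSpace ℝ (Fin m)) 1 =>
      MvPolynomial.eval (fun i => (w : EuclideanSpace ℝ (Fin m)) i) Q)
    (fun r : Set.Ioi (0 : ℝ) => (r : ℝ) ^ d * Real.exp (-(r : ℝ) ^ 2)),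
    radial_integral, finrank_euclideanSpace_fin, mul_comm]
  have : (d : ℝ) + ((m - 1 : ℕ) : ℝ) + 1 = d + m := by
    rw [Nat.cast_sub hm]
    push_cast
    ring
  rw [this]
  rfl

/-! ### Algebraic recursion -/

section algebra
open MvPolynomial

/-- The linear form `⟨w, x⟩`. -/
noncomputable def linF {m : ℕ} (w : Fin m → ℝ) : MvPolynomial (Fin m) ℝ := ∑ i, C (w i) * X i

/-- The directional derivative. -/
noncomputable def dirD {m : ℕ} (w : Fin m → ℝ) (P : MvPolynomial (Fin m) ℝ) :
    MvPolynomial (Fin m) ℝ := ∑ i, C (w i) * pderiv i P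

lemma linF_hom {m : ℕ} (w : Fin m → ℝ) : (linF w).IsHomogeneous 1 := by
  refine IsHomogeneous.sum _ _ _ fun i _ => ?_
  simpa using (isHomogeneous_C (Fin m) (w i)).mul (isHomogeneous_X ℝ i)

lemma dirD_hom {m l : ℕ} (w : Fin m → ℝ) {P : MvPolynomial (Fin m) ℝ}
    (h : P.IsHomogeneous (l + 1)) : (dirD w P).IsHomogeneous l := by
  refine IsHomogeneous.sum _ _ _ fun i _ => ?_
  simpa using (isHomogeneous_C (Fin m) (w i)).mul (h.pderiv (i := i))

lemma pderiv_linF {m : ℕ} (w : Fin m → ℝ) (i : Fin m) : pderiv i (linF w) = C (w i) := by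
  classical
  unfold linF
  rw [map_sum, Finset.sum_eq_single i]
  · simp
  · intro j _ hj
    simp [pderiv_X_of_ne hj]
  · simp

lemma pderiv_comm' {m : ℕ} (i j : Fin m) (P : MvPolynomial (Fin m) ℝ) :
    pderiv i (pderiv j P) = pderiv j (pderiv i P) := by
  classical
  induction P using MvPolynomial.induction_on with
  | C a => simp
  | add p q hp hq => simp [hp, hq]
  | mul_X p n hp =>
    have hX : ∀ a b : Fin m, pderiv a (pderiv b (X n : MvPolynomial (Fin m) ℝ)) = 0 := by
      intro a b
      rw [pderiv_X]
      by_cases hb : b = n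
      · subst hb; simp
      · simp [hb]
    simp only [pderiv_mul, map_add, hX, hp]
    ring

lemma dirD_harm {m : ℕ} (w : Fin m → ℝ) {P : MvPolynomial (Fin m) ℝ}
    (h : ∑ j, pderiv j (pderiv j P) = 0) : ∑ j, pderiv j (pderiv j (dirD w P)) = 0 := by
  unfold dirD
  simp only [map_sum, pderiv_C_mul]
  rw [Finset.sum_comm]
  have : ∀ i, ∑ j, C (w i) * pderiv j (pderiv j (pderiv i P)) = 0 := by
    intro i
    have h2 := congrArg (pderiv i) h
    rw [map_sum, map_zero] at h2
    have h3 : ∑ j, pderiv j (pderiv j (pderiv i P)) = 0 := by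
      rw [← h2]
      refine Finset.sum_congr rfl fun j _ => ?_
      rw [pderiv_comm' i j, pderiv_comm' i j]
    rw [← Finset.mul_sum, h3, mul_zero]
  exact Finset.sum_eq_zero fun i _ => this i

lemma eval_dirD {m l : ℕ} (w : Fin m → ℝ) {P : MvPolynomial (Fin m) ℝ}
    (h : P.IsHomogeneous l) : eval w (dirD w P) = l * eval w P := by
  have := congrArg (eval w) h.sum_X_mul_pderiv
  simpa [dirD] using this

lemma gaussL_rec {m l : ℕ} (w : Fin m → ℝ) (k : ℕ) {P : MvPolynomial (Fin m) ℝ}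
    (hP : P.IsHomogeneous l) (hh : ∑ j, pderiv j (pderiv j P) = 0) :
    l * gaussL (linF w ^ k * P) = k / 2 * gaussL (linF w ^ (k - 1) * dirD w P) := by
  rw [← gaussL_C_mul, ← gaussL_C_mul]
  have e1 : C (l : ℝ) * (linF w ^ k * P) = ∑ i, X i * (linF w ^ k * pderiv i P) := by
    have := hP.sum_X_mul_pderiv
    rw [nsmul_eq_mul] at this
    rw [map_natCast, mul_left_comm, ← this, Finset.mul_sum]
    refine Finset.sum_congr rfl fun i _ => ?_
    ring
  rw [e1, gaussL_sum]
  simp_rw [gaussL_X_mul]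
  rw [← Finset.mul_sum, ← gaussL_sum]
  have e2 : ∑ i, pderiv i (linF w ^ k * pderiv i P) =
      C (k : ℝ) * (linF w ^ (k - 1) * dirD w P) := by
    simp_rw [pderiv_mul, pderiv_pow, pderiv_linF]
    rw [Finset.sum_add_distrib, ← Finset.mul_sum, hh, mul_zero, add_zero, dirD, Finset.mul_sum,
      Finset.mul_sum]
    refine Finset.sum_congr rfl fun i _ => ?_
    rw [map_natCast]
    ring
  rw [e2, gaussL_C_mul, gaussL_C_mul]
  ring

lemma gaussL_linF {m : ℕ} (w : Fin m → ℝ) (hw : ∑ i, w i ^ 2 = 1) (k : ℕ) :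
    gaussL (linF w ^ (k + 1)) = k / 2 * gaussL (linF w ^ (k - 1)) := by
  have e1 : linF w ^ (k + 1) = ∑ i, C (w i) * (X i * linF w ^ k) := by
    rw [pow_succ', linF, Finset.sum_mul]
    refine Finset.sum_congr rfl fun i _ => ?_
    ring
  rw [e1, gaussL_sum]
  simp_rw [gaussL_C_mul, gaussL_X_mul, pderiv_pow, pderiv_linF]
  have : ∀ i, w i * (1 / 2 * gaussL ((k : MvPolynomial (Fin m) ℝ) * linF w ^ (k - 1) * C (w i))) =
      w i ^ 2 * (k / 2 * gaussL (linF w ^ (k - 1))) := by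
    intro i
    have : (k : MvPolynomial (Fin m) ℝ) * linF w ^ (k - 1) * C (w i) =
      C (w i) * (C (k : ℝ) * linF w ^ (k - 1)) := by
      rw [map_natCast]; ring
    rw [this, gaussL_C_mul, gaussL_C_mul]
    ring
  simp_rw [this]
  rw [← Finset.sum_mul, hw, one_mul]

lemma sphI_main {m : ℕ} (hm : 1 ≤ m) (w : Fin m → ℝ) (hw : ∑ i, w i ^ 2 = 1) (A : ℕ → ℕ → ℝ)
    (hA00 : A 0 0 = sphI (1 : MvPolynomial (Fin m) ℝ)) (hA10 : A 1 0 = 0)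
    (hAk : ∀ k : ℕ, (k + m) * A (k + 2) 0 = (k + 1) * A k 0)
    (hAl : ∀ l : ℕ, A 0 (l + 1) = 0)
    (hAkl : ∀ k l : ℕ, (k + l + m) * A (k + 1) (l + 1) = (k + 1) * A k l) :
    ∀ (l k : ℕ) (P : MvPolynomial (Fin m) ℝ), P.IsHomogeneous l →
      ∑ j, pderiv j (pderiv j P) = 0 → sphI (linF w ^ k * P) = A k l * eval w P := by
  have hm' : (1:ℝ) ≤ m := by exact_mod_cast hm
  have hpol : ∀ (l k : ℕ) (P : MvPolynomial (Fin m) ℝ), P.IsHomogeneous l →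
      gaussL (linF w ^ k * P) = Real.Gamma (((k : ℝ) + l + m) / 2) / 2 * sphI (linF w ^ k * P) := by
    intro l k P hP
    have := gaussL_polar hm (((linF_hom w).pow k).mul hP)
    simpa using this
  have hG : ∀ x : ℝ, 0 < x → Real.Gamma x ≠ 0 := fun x hx => (Real.Gamma_pos_of_pos hx).ne'
  intro l
  induction l with
  | zero =>
    have key : ∀ k : ℕ, sphI (linF w ^ k) = A k 0 ∧ sphI (linF w ^ (k + 1)) = A (k + 1) 0 := by
      have hp0 : ∀ k : ℕ, gaussL (linF w ^ k) =
          Real.Gamma (((k : ℝ) + m) / 2) / 2 * sphI (linF w ^ k) := by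
        intro k
        have := hpol 0 k 1 (isHomogeneous_one _ _)
        simpa using this
      intro k
      induction k with
      | zero =>
        refine ⟨by simp [hA00], ?_⟩
        have h1 := gaussL_linF w hw 0
        rw [hp0] at h1
        have := hG ((1 + m : ℝ) / 2) (by positivity)
        rw [zero_add, hA10]
        simpa [this] using h1
      | succ k ih =>
        refine ⟨ih.2, ?_⟩
        have h1 := gaussL_linF w hw (k + 1)
        rw [hp0, Nat.add_sub_cancel, hp0, ih.1] at h1
        have h2 := hAk k
        have h3 : (((k + 1 + 1 : ℕ) : ℝ) + m) / 2 = ((k : ℝ) + m) / 2 + 1 := by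
          push_cast; ring
        have hpos : (0:ℝ) < ((k : ℝ) + m) / 2 := by positivity
        rw [h3, Real.Gamma_add_one hpos.ne'] at h1
        have h4 := hG _ hpos
        have h5 : ((k : ℝ) + m) * sphI (linF w ^ (k + 1 + 1)) = (k + 1) * A k 0 := by
          push_cast at h1
          have : Real.Gamma (((k : ℝ) + m) / 2) * (((k : ℝ) + m) * sphI (linF w ^ (k + 1 + 1))) =
            Real.Gamma (((k : ℝ) + m) / 2) * ((k + 1) * A k 0) := by linarith
          exact mul_left_cancel₀ h4 this
        have h6 : ((k : ℝ) + m) ≠ 0 := by positivity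
        exact mul_left_cancel₀ h6 (h5.trans h2.symm)
    intro k P hP _
    rw [← totalDegree_zero_iff_isHomogeneous, totalDegree_eq_zero_iff_eq_C] at hP
    rw [hP, eval_C]
    have : sphI (linF w ^ k * C (coeff 0 P)) = sphI (linF w ^ k) * coeff 0 P := by
      unfold sphI
      rw [← integral_mul_const]
      simp
    rw [this, (key k).1]
  | succ l ih =>
    intro k P hP hh
    have h1 := gaussL_rec w k hP hh
    have hl : ((l + 1 : ℕ) : ℝ) ≠ 0 := by positivity
    rw [hpol _ _ _ hP] at h1
    rcases k with _ | k
    · have := hG ((l + 1 + m : ℝ) / 2) (by positivity)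
      have hl : (l + 1 : ℝ) ≠ 0 := by positivity
      rw [hAl, zero_mul]
      simpa [this, hl] using h1
    · have hd := dirD_hom w hP
      rw [Nat.add_sub_cancel, hpol _ _ _ hd, ih k _ hd (dirD_harm w hh), eval_dirD w hP] at h1
      have h2 := hAkl k l
      have h3 : (((k + 1 : ℕ) : ℝ) + (l + 1 : ℕ) + m) / 2 = ((k : ℝ) + l + m) / 2 + 1 := by
        push_cast; ring
      have hpos : (0:ℝ) < ((k : ℝ) + l + m) / 2 := by positivity
      rw [h3, Real.Gamma_add_one hpos.ne'] at h1
      have h4 := hG _ hpos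
      have h6 : ((k : ℝ) + l + m) ≠ 0 := by positivity
      refine mul_left_cancel₀ h6 (mul_left_cancel₀ h4 (mul_left_cancel₀ hl ?_))
      rw [← mul_assoc ((k : ℝ) + l + m) (A _ _), h2]
      push_cast at h1 ⊢
      linarith

end algebra

/-! ### Trigonometric integrals -/

/-- `∫_0^π cos^n sin^s`. -/
noncomputable def trigW (n s : ℕ) : ℝ :=
  ∫ t in (0:ℝ)..Real.pi, Real.cos t ^ n * Real.sin t ^ s

lemma trigW_ibp (n s : ℕ) : (n + 1) * trigW n (s + 2) = (s + 1) * trigW (n + 2) s := by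
  have h := intervalIntegral.integral_eq_sub_of_hasDerivAt (a := 0) (b := Real.pi)
    (f := fun t => Real.cos t ^ (n + 1) * Real.sin t ^ (s + 1))
    (f' := fun t => (s + 1) * (Real.cos t ^ (n + 2) * Real.sin t ^ s) -
      (n + 1) * (Real.cos t ^ n * Real.sin t ^ (s + 2)))
    (fun t _ => by
      have h1 := ((Real.hasDerivAt_cos t).fun_pow (n + 1)).fun_mul
        ((Real.hasDerivAt_sin t).fun_pow (s + 1))
      refine h1.congr_deriv ?_
      push_cast
      ring)
    (Continuous.intervalIntegrable (by fun_prop) _ _)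
  rw [intervalIntegral.integral_sub (Continuous.intervalIntegrable (by fun_prop) _ _)
    (Continuous.intervalIntegrable (by fun_prop) _ _), intervalIntegral.integral_const_mul,
    intervalIntegral.integral_const_mul] at h
  simp only [Real.sin_pi, Real.sin_zero, ne_eq, Nat.succ_ne_zero, not_false_eq_true, zero_pow,
    mul_zero, sub_zero] at h
  unfold trigW
  linarith

lemma trigW_split (n s : ℕ) : trigW n (s + 2) = trigW n s - trigW (n + 2) s := by
  unfold trigW
  rw [← intervalIntegral.integral_sub (Continuous.intervalIntegrable (by fun_prop) _ _)
    (Continuous.intervalIntegrable (by fun_prop) _ _)]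
  refine intervalIntegral.integral_congr fun t _ => ?_
  have := Real.sin_sq t
  simp only [pow_add, this]
  ring

lemma trigW_cos (n s : ℕ) : (n + s + 2) * trigW (n + 2) s = (n + 1) * trigW n s := by
  have h1 := trigW_ibp n s
  rw [trigW_split] at h1
  linarith

lemma trigW_sin (n s : ℕ) : (n + s + 2) * trigW n (s + 2) = (s + 1) * trigW n s := by
  have h1 := trigW_ibp n s
  have h2 := trigW_split n s
  linear_combination h1 + ((s:ℝ)+1) * h2

lemma trigW_one (s : ℕ) : trigW 1 s = 0 := by
  have h := intervalIntegral.integral_eq_sub_of_hasDerivAt (a := 0) (b := Real.pi)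
    (f := fun t => Real.sin t ^ (s + 1))
    (f' := fun t => (s + 1) * (Real.cos t ^ 1 * Real.sin t ^ s))
    (fun t _ => by
      refine ((Real.hasDerivAt_sin t).fun_pow (s + 1)).congr_deriv ?_
      push_cast
      ring)
    (Continuous.intervalIntegrable (by fun_prop) _ _)
  rw [intervalIntegral.integral_const_mul] at h
  have h2 : ((s : ℝ) + 1) ≠ 0 := by positivity
  unfold trigW
  simpa [h2] using h

lemma trigW_zero (s : ℕ) :
    trigW 0 s * Real.Gamma ((s : ℝ) / 2 + 1) = Real.sqrt Real.pi * Real.Gamma (((s : ℝ) + 1) / 2) := by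
  induction s using Nat.twoStepInduction with
  | zero =>
    have : trigW 0 0 = Real.pi := by simp [trigW]
    rw [this]
    have h2 : ((0 : ℕ) + 1 : ℝ) / 2 = 1 / 2 := by norm_num
    rw [h2, Real.Gamma_one_half_eq, Real.mul_self_sqrt Real.pi_pos.le]
    simp
  | one =>
    have : trigW 0 1 = 2 := by
      simp [trigW]
      norm_num
    rw [this]
    have h2 : ((1 : ℕ) + 1 : ℝ) / 2 = 1 := by norm_num
    have h3 : ((1 : ℕ) : ℝ) / 2 + 1 = 1 / 2 + 1 := by norm_num
    rw [h2, h3, Real.Gamma_add_one (by norm_num), Real.Gamma_one_half_eq, Real.Gamma_one]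
    ring
  | more s ih _ =>
    have h1 := trigW_sin 0 s
    have h2 : ((s + 2 : ℕ) : ℝ) / 2 + 1 = ((s : ℝ) / 2 + 1) + 1 := by push_cast; ring
    have h3 : (((s + 2 : ℕ) : ℝ) + 1) / 2 = ((s : ℝ) + 1) / 2 + 1 := by push_cast; ring
    have p1 : (s : ℝ) / 2 + 1 ≠ 0 := by positivity
    have p2 : ((s : ℝ) + 1) / 2 ≠ 0 := by positivity
    rw [h2, h3, Real.Gamma_add_one p1, Real.Gamma_add_one p2]
    push_cast at h1
    linear_combination ((s:ℝ)+1)/2 * ih + Real.Gamma ((s : ℝ) / 2 + 1) / 2 * h1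

/-- The polynomials appearing in the Rodrigues formula. -/
noncomputable def rodQ (c : ℝ) : ℕ → Polynomial ℝ
  | 0 => 1
  | j + 1 => (1 - Polynomial.X ^ 2) * Polynomial.derivative (rodQ c j) -
      Polynomial.C (c - 2 * j) * Polynomial.X * rodQ c j

lemma rodQ_integral (j : ℕ) : ∀ (s k : ℕ),
    ∫ t in (0:ℝ)..Real.pi, Real.cos t ^ k * (rodQ ((s + 2 * j : ℕ) : ℝ) j).eval (Real.cos t) *
      Real.sin t ^ (s + 1) =
    (-1) ^ j * (k.descFactorial j : ℝ) * trigW (k - j) (s + 2 * j + 1) := by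
  induction j with
  | zero => intro s k; simp [rodQ, trigW]
  | succ j ih =>
    intro s k
    set c : ℝ := ((s + 2 * (j + 1) : ℕ) : ℝ) with hc
    have h := intervalIntegral.integral_eq_sub_of_hasDerivAt (a := 0) (b := Real.pi)
      (f := fun t => Real.cos t ^ k * (rodQ c j).eval (Real.cos t) * Real.sin t ^ (s + 2))
      (f' := fun t => -(k * (Real.cos t ^ (k - 1) * (rodQ c j).eval (Real.cos t) *
          Real.sin t ^ (s + 2 + 1))) -
        Real.cos t ^ k * (rodQ c (j + 1)).eval (Real.cos t) * Real.sin t ^ (s + 1))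
      (fun t _ => by
        have h1 := (((Real.hasDerivAt_cos t).fun_pow k).fun_mul
          (((rodQ c j).hasDerivAt (Real.cos t)).comp t (Real.hasDerivAt_cos t))).fun_mul
          ((Real.hasDerivAt_sin t).fun_pow (s + 2))
        refine h1.congr_deriv ?_
        have hs : s + 2 - 1 = s + 1 := rfl
        simp only [Function.comp, rodQ, Polynomial.eval_sub, Polynomial.eval_mul,
          Polynomial.eval_one, Polynomial.eval_pow, Polynomial.eval_X, Polynomial.eval_C, hs]
        have hcs : c - 2 * j = s + 2 := by rw [hc]; push_cast; ring
        rw [hcs]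
        have h2 : (1 : ℝ) - Real.cos t ^ 2 = Real.sin t ^ 2 := by
          rw [Real.sin_sq]
        rw [h2]
        push_cast
        ring)
      (Continuous.intervalIntegrable (by fun_prop) _ _)
    rw [intervalIntegral.integral_sub (Continuous.intervalIntegrable (by fun_prop) _ _)
      (Continuous.intervalIntegrable (by fun_prop) _ _), intervalIntegral.integral_neg,
      intervalIntegral.integral_const_mul] at h
    simp only [Real.sin_pi, Real.sin_zero, ne_eq, Nat.succ_ne_zero, not_false_eq_true, zero_pow,
      mul_zero, sub_zero] at h
    have h3 := ih (s + 2) (k - 1)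
    have hc' : ((s + 2 + 2 * j : ℕ) : ℝ) = c := by rw [hc]; push_cast; ring
    rw [hc'] at h3
    rw [h3] at h
    have h4 : s + 2 * (j + 1) + 1 = s + 2 + 2 * j + 1 := by ring
    rw [h4]
    rcases k with _ | k
    · simp at h ⊢
      linarith
    · rw [Nat.succ_descFactorial_succ, Nat.add_sub_add_right]
      rw [Nat.add_sub_cancel] at h
      push_cast at h ⊢
      rw [pow_succ]
      linarith

lemma rodQ_iteratedDeriv (c : ℝ) (j : ℕ) : ∀ x ∈ Set.Ioo (-1 : ℝ) 1,
    iteratedDeriv j (fun y : ℝ => (1 - y ^ 2) ^ (c / 2)) x =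
      (1 - x ^ 2) ^ (c / 2 - j) * (rodQ c j).eval x := by
  induction j with
  | zero => intro x _; simp [rodQ]
  | succ j ih =>
    intro x hx
    rw [iteratedDeriv_succ]
    have hev : iteratedDeriv j (fun y : ℝ => (1 - y ^ 2) ^ (c / 2)) =ᶠ[nhds x]
        fun y => (1 - y ^ 2) ^ (c / 2 - j) * (rodQ c j).eval y :=
      Filter.eventuallyEq_of_mem (Ioo_mem_nhds hx.1 hx.2) ih
    rw [hev.deriv_eq]
    have hpos : 0 < 1 - x ^ 2 := by nlinarith [hx.1, hx.2]
    have h1 := (((hasDerivAt_pow 2 x).const_sub 1).rpow_const (p := c / 2 - j)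
      (Or.inl hpos.ne')).fun_mul ((rodQ c j).hasDerivAt x)
    rw [h1.deriv]
    have e1 : (1 - x ^ 2) ^ (c / 2 - j) = (1 - x ^ 2) ^ (c / 2 - j - 1) * (1 - x ^ 2) := by
      rw [← Real.rpow_add_one hpos.ne']
      ring_nf
    have e2 : c / 2 - ((j + 1 : ℕ) : ℝ) = c / 2 - j - 1 := by push_cast; ring
    rw [e1, e2]
    simp only [rodQ, Polynomial.eval_sub, Polynomial.eval_mul,
          Polynomial.eval_one, Polynomial.eval_pow, Polynomial.eval_X, Polynomial.eval_C]
    push_cast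
    ring

/-! ### The Funk–Hecke coefficient -/

/-- The constant in front, for `l = 0`, with `m = M + 3`. -/
noncomputable def kap0 (M : ℕ) : ℝ :=
  2 ^ (M + 1) * Real.pi ^ (((M : ℝ) + 1) / 2) * Real.Gamma (((M : ℝ) + 1) / 2) /
    Real.Gamma ((M : ℝ) + 1)

/-- The constant in front, with `m = M + 3`. -/
noncomputable def kap (M l : ℕ) : ℝ :=
  kap0 M * (-1 / 2) ^ l / (ascPochhammer ℝ l).eval (((M : ℝ) + 2) / 2)

lemma asc_Gamma (x : ℝ) (hx : 0 < x) (l : ℕ) :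
    (ascPochhammer ℝ l).eval x * Real.Gamma x = Real.Gamma (x + l) := by
  induction l with
  | zero => simp
  | succ l ih =>
    have h : x + ((l + 1 : ℕ) : ℝ) = x + l + 1 := by push_cast; ring
    have hp : x + (l : ℝ) ≠ 0 := by positivity
    rw [ascPochhammer_succ_eval, h, Real.Gamma_add_one hp, ← ih]
    ring

lemma gegenC_eq (M l : ℕ) (x : ℝ) (hx : x ∈ Set.Ioo (-1 : ℝ) 1) :
    gegenC (((M : ℝ) + 1) / 2) l x = (-1/2 : ℝ) ^ l *
      ((ascPochhammer ℝ l).eval ((M : ℝ) + 1) /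
      ((Nat.factorial l : ℝ) * (ascPochhammer ℝ l).eval (((M : ℝ) + 2) / 2))) *
      (rodQ ((M + 2 * l : ℕ) : ℝ) l).eval x := by
  have hpos : 0 < 1 - x ^ 2 := by nlinarith [hx.1, hx.2]
  unfold gegenC
  have e1 : (l : ℝ) + ((M : ℝ) + 1) / 2 - 1 / 2 = ((M + 2 * l : ℕ) : ℝ) / 2 := by
    push_cast; ring
  have e2 : 2 * (((M : ℝ) + 1) / 2) = (M : ℝ) + 1 := by ring
  have e3 : ((M : ℝ) + 1) / 2 + 1 / 2 = ((M : ℝ) + 2) / 2 := by ring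
  have e4 : (1 - x ^ 2) ^ (-(((M : ℝ) + 1) / 2) + 1 / 2) *
      (1 - x ^ 2) ^ (((M + 2 * l : ℕ) : ℝ) / 2 - l) = 1 := by
    rw [← Real.rpow_add hpos]
    have : -(((M : ℝ) + 1) / 2) + 1 / 2 + (((M + 2 * l : ℕ) : ℝ) / 2 - l) = 0 := by
      push_cast; ring
    rw [this, Real.rpow_zero]
  rw [e1, e2, e3, rodQ_iteratedDeriv _ _ x hx]
  rw [mul_assoc, ← mul_assoc ((1 - x ^ 2) ^ _), e4, one_mul]

lemma coeff_eq (M l : ℕ) (h : ℝ → ℝ) :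
    funkHeckeCoeff (M + 3) l h = kap M l *
      ∫ t in (0:ℝ)..Real.pi, h (Real.cos t) *
        (rodQ ((M + 2 * l : ℕ) : ℝ) l).eval (Real.cos t) * Real.sin t ^ (M + 1) := by
  unfold funkHeckeCoeff
  have e0 : (((M + 3 : ℕ) : ℝ) - 2) / 2 = ((M : ℝ) + 1) / 2 := by push_cast; ring
  have e1 : ((M + 3 : ℕ) : ℝ) - 2 + l = (M : ℝ) + 1 + l := by push_cast; ring
  have e2 : M + 3 - 2 = M + 1 := rfl
  rw [e0, e1, e2]
  have hint : ∫ θ in (0:ℝ)..Real.pi, h (Real.cos θ) *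
        gegenTilde (((M : ℝ) + 1) / 2) l (Real.cos θ) * Real.sin θ ^ (M + 1) =
      ∫ t in (0:ℝ)..Real.pi, (Real.Gamma (((M : ℝ) + 1) / 2) * ((-1/2 : ℝ) ^ l *
      ((ascPochhammer ℝ l).eval ((M : ℝ) + 1) /
      ((Nat.factorial l : ℝ) * (ascPochhammer ℝ l).eval (((M : ℝ) + 2) / 2))))) *
        (h (Real.cos t) *
        (rodQ ((M + 2 * l : ℕ) : ℝ) l).eval (Real.cos t) * Real.sin t ^ (M + 1)) := by
    refine intervalIntegral.integral_congr_Ioo_of_le Real.pi_pos.le fun t ht => ?_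
    have hs := Real.sin_pos_of_mem_Ioo ht
    have hcs := Real.sin_sq_add_cos_sq t
    have hx : Real.cos t ∈ Set.Ioo (-1 : ℝ) 1 := by
      rw [Set.mem_Ioo, ← abs_lt, ← sq_lt_one_iff_abs_lt_one]
      nlinarith
    simp only [gegenTilde]
    rw [gegenC_eq M l _ hx]
    ring
  rw [hint, intervalIntegral.integral_const_mul, ← mul_assoc]
  congr 1
  unfold kap kap0
  rw [← asc_Gamma ((M : ℝ) + 1) (by positivity) l]
  have n1 : (ascPochhammer ℝ l).eval ((M : ℝ) + 1) ≠ 0 :=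
    (ascPochhammer_pos l _ (by positivity)).ne'
  have n2 : (ascPochhammer ℝ l).eval (((M : ℝ) + 2) / 2) ≠ 0 :=
    (ascPochhammer_pos l _ (by positivity)).ne'
  have n3 : Real.Gamma ((M : ℝ) + 1) ≠ 0 := (Real.Gamma_pos_of_pos (by positivity)).ne'
  have n4 : (Nat.factorial l : ℝ) ≠ 0 := by positivity
  field_simp

/-- The coefficient for `h = t^k`. -/
noncomputable def cA (M k l : ℕ) : ℝ :=
  kap M l * ((-1) ^ l * (k.descFactorial l : ℝ) * trigW (k - l) (M + 2 * l + 1))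

lemma kap_succ (M l : ℕ) : (M + 2 + 2 * l) * kap M (l + 1) = - kap M l := by
  unfold kap
  have n2 : (ascPochhammer ℝ l).eval (((M : ℝ) + 2) / 2) ≠ 0 :=
    (ascPochhammer_pos l _ (by positivity)).ne'
  have n3 : ((M : ℝ) + 2) / 2 + l ≠ 0 := by positivity
  have n4 : (M : ℝ) + 2 + 2 * l ≠ 0 := by positivity
  rw [ascPochhammer_succ_eval, pow_succ]
  have : ((M : ℝ) + 2) / 2 + l = ((M : ℝ) + 2 + 2 * l) / 2 := by ring
  rw [this]
  field_simp

lemma cA_kl (M k l : ℕ) :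
    ((k : ℝ) + l + (M + 3 : ℕ)) * cA M (k + 1) (l + 1) = (k + 1) * cA M k l := by
  unfold cA
  rw [Nat.succ_descFactorial_succ, Nat.add_sub_add_right]
  rcases le_or_gt l k with hlk | hlk
  · have h1 := trigW_sin (k - l) (M + 2 * l + 1)
    have h2 := kap_succ M l
    have e : M + 2 * (l + 1) + 1 = M + 2 * l + 1 + 2 := by ring
    rw [e]
    rw [Nat.cast_sub hlk] at h1
    push_cast at h1 ⊢
    rw [pow_succ]
    linear_combination (-(kap M (l+1)) * (-1) ^ l * (k + 1) * (k.descFactorial l : ℝ)) * h1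
      - ((-1) ^ l * (k + 1) * (k.descFactorial l : ℝ) * trigW (k - l) (M + 2 * l + 1)) * h2
  · rw [Nat.descFactorial_eq_zero_iff_lt.2 hlk]
    simp

lemma cA_k (M k : ℕ) :
    ((k : ℝ) + (M + 3 : ℕ)) * cA M (k + 2) 0 = (k + 1) * cA M k 0 := by
  have h := trigW_cos k (M + 1)
  simp only [cA, Nat.descFactorial_zero, Nat.sub_zero, mul_zero, add_zero, pow_zero]
  push_cast at h ⊢
  linear_combination kap M 0 * h

lemma cA_00 (M : ℕ) : cA M 0 0 = sphI (1 : MvPolynomial (Fin (M + 3)) ℝ) := by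
  have h1 := gaussL_polar (m := M + 3) (by omega) (MvPolynomial.isHomogeneous_one (Fin (M + 3)) ℝ)
  rw [gaussL_one] at h1
  have h2 := trigW_zero (M + 1)
  have h3 := Real.Gamma_mul_Gamma_add_half (((M : ℝ) + 1) / 2)
  have a1 : (((0 : ℕ) : ℝ) + (M + 3 : ℕ)) / 2 = ((M : ℝ) + 3) / 2 := by push_cast; ring
  have a2 : ((M + 1 : ℕ) : ℝ) / 2 + 1 = ((M : ℝ) + 3) / 2 := by push_cast; ring
  have a3 : (((M + 1 : ℕ) : ℝ) + 1) / 2 = ((M : ℝ) + 1) / 2 + 1 / 2 := by push_cast; ring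
  have a4 : 2 * (((M : ℝ) + 1) / 2) = (M : ℝ) + 1 := by ring
  have a5 : (1 : ℝ) - ((M : ℝ) + 1) = -(M : ℝ) := by ring
  rw [a1] at h1
  rw [a2, a3] at h2
  rw [a4, a5, Real.rpow_neg (by norm_num), Real.rpow_natCast] at h3
  have n3 : Real.Gamma ((M : ℝ) + 1) ≠ 0 := (Real.Gamma_pos_of_pos (by positivity)).ne'
  have n5 : Real.Gamma (((M : ℝ) + 3) / 2) ≠ 0 := (Real.Gamma_pos_of_pos (by positivity)).ne'
  have n6 : Real.sqrt Real.pi ≠ 0 := (Real.sqrt_pos.2 Real.pi_pos).ne'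
  have hpi : Real.pi ^ (((M : ℝ) + 1) / 2) = Real.sqrt Real.pi ^ (M + 1) := by
    rw [Real.sqrt_eq_rpow, ← Real.rpow_natCast, ← Real.rpow_mul Real.pi_pos.le]
    congr 1
    push_cast
    ring
  simp only [cA, kap, kap0, Nat.descFactorial_zero, Nat.sub_zero, mul_zero, add_zero, pow_zero,
    hpi, ascPochhammer_zero, Polynomial.eval_one]
  refine mul_left_cancel₀ (mul_ne_zero n5 (by norm_num : (1 / 2 : ℝ) ≠ 0)) ?_
  have h1' : Real.Gamma (((M : ℝ) + 3) / 2) * (1 / 2) * sphI (1 : MvPolynomial (Fin (M + 3)) ℝ) =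
    Real.sqrt Real.pi ^ (M + 3) := by rw [h1]; ring
  rw [h1']
  push_cast
  have h4 : Real.Gamma (((M : ℝ) + 1) / 2) * (trigW 0 (M + 1) *
      Real.Gamma (((M : ℝ) + 3) / 2)) * 2 ^ M = Real.pi.sqrt ^ 2 * Real.Gamma ((M : ℝ) + 1) := by
    rw [h2, mul_left_comm, h3]
    field_simp
  have h5 : (2:ℝ) ^ (M + 1) = 2 * 2 ^ M := by ring
  rw [h5, one_mul, mul_one, div_one]
  field_simp
  linear_combination Real.pi.sqrt ^ (M + 1) * h4

lemma cA_eq (M k l : ℕ) :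
    kap M l * ∫ t in (0:ℝ)..Real.pi, Real.cos t ^ k *
        (rodQ ((M + 2 * l : ℕ) : ℝ) l).eval (Real.cos t) * Real.sin t ^ (M + 1) = cA M k l := by
  rw [rodQ_integral, cA]

/-! ### Final assembly -/

lemma hom_of_scale {m l : ℕ} (P : MvPolynomial (Fin m) ℝ)
    (hhom : ∀ lam : ℝ, 0 < lam → ∀ x : EuclideanSpace ℝ (Fin m),
      MvPolynomial.eval (fun i => lam * x i) P =
        lam ^ l * MvPolynomial.eval (fun i => x i) P) : P.IsHomogeneous l := by
  let R : MvPolynomial (Fin m) ℝ :=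
    ∑ a ∈ P.support, MvPolynomial.monomial a ((2:ℝ) ^ (∑ i, a i) * P.coeff a)
  have hR : R = MvPolynomial.C ((2:ℝ) ^ l) * P := by
    refine MvPolynomial.funext fun x => ?_
    have := hhom 2 two_pos (WithLp.toLp 2 x)
    simp only at this
    rw [map_mul, MvPolynomial.eval_C, ← this, MvPolynomial.eval_eq' _ P]
    simp only [R, map_sum, MvPolynomial.eval_monomial]
    refine Finset.sum_congr rfl fun a _ => ?_
    rw [Finsupp.prod_fintype _ _ (by simp)]
    simp_rw [mul_pow, Finset.prod_mul_distrib, Finset.prod_pow_eq_pow_sum]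
    ring
  intro a ha
  have h1 := congrArg (MvPolynomial.coeff a) hR
  rw [MvPolynomial.coeff_C_mul] at h1
  have h2 : MvPolynomial.coeff a R = (2:ℝ) ^ (∑ i, a i) * P.coeff a := by
    classical
    simp only [R, MvPolynomial.coeff_sum, MvPolynomial.coeff_monomial]
    rw [Finset.sum_ite_eq' P.support a]
    simp [ha]
  rw [h2] at h1
  have h3 := mul_right_cancel₀ ha h1
  have h4 := pow_right_injective₀ (two_pos (α := ℝ)) (by norm_num) h3
  rw [Finsupp.weight_apply, Finsupp.sum_fintype _ _ (by simp)]
  simpa using h4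

lemma inner_eq_linF {m : ℕ} (w x : EuclideanSpace ℝ (Fin m)) :
    ⟪w, x⟫ = MvPolynomial.eval (fun i => x i) (linF (fun i => w i)) := by
  simp [linF, PiLp.inner_apply, mul_comm]

lemma continuous_eval_sphere {m : ℕ} (P : MvPolynomial (Fin m) ℝ) :
    Continuous fun w : Metric.sphere (0 : EuclideanSpace ℝ (Fin m)) 1 =>
      MvPolynomial.eval (fun i => (w : EuclideanSpace ℝ (Fin m)) i) P :=
  (MvPolynomial.continuous_eval P).comp (by fun_prop)

lemma sphere_integrable {m : ℕ} {f : Metric.sphere (0 : EuclideanSpace ℝ (Fin m)) 1 → ℝ}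
    (hf : Continuous f) :
    Integrable f ((volume : Measure (EuclideanSpace ℝ (Fin m))).toSphere) :=
  hf.integrable_of_hasCompactSupport (HasCompactSupport.of_compactSpace f)

lemma poly_case (M l : ℕ) (P : MvPolynomial (Fin (M + 3)) ℝ)
    (hharm : ∑ j, MvPolynomial.pderiv j (MvPolynomial.pderiv j P) = 0)
    (hP : P.IsHomogeneous l)
    (w : Metric.sphere (0 : EuclideanSpace ℝ (Fin (M + 3))) 1) (p : Polynomial ℝ) :
    ∫ w' : Metric.sphere (0 : EuclideanSpace ℝ (Fin (M + 3))) 1,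
          p.eval ⟪(w : EuclideanSpace ℝ (Fin (M + 3))), (w' : EuclideanSpace ℝ (Fin (M + 3)))⟫ *
            MvPolynomial.eval (fun i => (w' : EuclideanSpace ℝ (Fin (M + 3))) i) P
          ∂((volume : Measure (EuclideanSpace ℝ (Fin (M + 3)))).toSphere) =
      (kap M l * ∫ t in (0:ℝ)..Real.pi, p.eval (Real.cos t) *
        (rodQ ((M + 2 * l : ℕ) : ℝ) l).eval (Real.cos t) * Real.sin t ^ (M + 1)) *
          MvPolynomial.eval (fun i => (w : EuclideanSpace ℝ (Fin (M + 3))) i) P := by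
  induction p using Polynomial.induction_on' with
  | add p q hp hq =>
    simp only [Polynomial.eval_add, add_mul]
    rw [integral_add, hp, hq, intervalIntegral.integral_add, mul_add, add_mul]
    · exact Continuous.intervalIntegrable (by fun_prop) _ _
    · exact Continuous.intervalIntegrable (by fun_prop) _ _
    · exact sphere_integrable ((p.continuous.comp (by fun_prop)).mul (continuous_eval_sphere P))
    · exact sphere_integrable ((q.continuous.comp (by fun_prop)).mul (continuous_eval_sphere P))
  | monomial k a =>
    have hw : ∑ i, (w : EuclideanSpace ℝ (Fin (M + 3))) i ^ 2 = 1 := by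
      have h1 := EuclideanSpace.norm_sq_eq (w : EuclideanSpace ℝ (Fin (M + 3)))
      rw [norm_eq_of_mem_sphere w] at h1
      simpa using h1.symm
    have h := sphI_main (m := M + 3) (by omega)
      (fun i => (w : EuclideanSpace ℝ (Fin (M + 3))) i) hw (cA M) (cA_00 M)
      (by simp [cA, trigW_one]) (cA_k M) (by intro l; simp [cA]) (cA_kl M) l k P hP hharm
    simp only [Polynomial.eval_monomial, mul_assoc]
    rw [integral_const_mul, intervalIntegral.integral_const_mul]
    simp only [← mul_assoc]
    rw [mul_comm (kap M l) a, mul_assoc a, cA_eq, mul_assoc, ← h]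
    congr 1
    unfold sphI
    refine integral_congr_ae (Filter.Eventually.of_forall fun w' => ?_)
    simp only [map_mul, map_pow]
    rw [inner_eq_linF]

lemma inner_mem {m : ℕ} (w w' : Metric.sphere (0 : EuclideanSpace ℝ (Fin m)) 1) :
    ⟪(w : EuclideanSpace ℝ (Fin m)), (w' : EuclideanSpace ℝ (Fin m))⟫ ∈ Set.Icc (-1 : ℝ) 1 := by
  rw [Set.mem_Icc, ← abs_le]
  have := abs_real_inner_le_norm (w : EuclideanSpace ℝ (Fin m)) (w' : EuclideanSpace ℝ (Fin m))
  rwa [norm_eq_of_mem_sphere w, norm_eq_of_mem_sphere w', mul_one] at this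

lemma cont_case (M l : ℕ) (P : MvPolynomial (Fin (M + 3)) ℝ)
    (hharm : ∑ j, MvPolynomial.pderiv j (MvPolynomial.pderiv j P) = 0)
    (hP : P.IsHomogeneous l)
    (w : Metric.sphere (0 : EuclideanSpace ℝ (Fin (M + 3))) 1) (h : ℝ → ℝ) (hc : Continuous h) :
    ∫ w' : Metric.sphere (0 : EuclideanSpace ℝ (Fin (M + 3))) 1,
          h ⟪(w : EuclideanSpace ℝ (Fin (M + 3))), (w' : EuclideanSpace ℝ (Fin (M + 3)))⟫ *
            MvPolynomial.eval (fun i => (w' : EuclideanSpace ℝ (Fin (M + 3))) i) P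
          ∂((volume : Measure (EuclideanSpace ℝ (Fin (M + 3)))).toSphere) =
      (kap M l * ∫ t in (0:ℝ)..Real.pi, h (Real.cos t) *
        (rodQ ((M + 2 * l : ℕ) : ℝ) l).eval (Real.cos t) * Real.sin t ^ (M + 1)) *
          MvPolynomial.eval (fun i => (w : EuclideanSpace ℝ (Fin (M + 3))) i) P := by
  set σ := ((volume : Measure (EuclideanSpace ℝ (Fin (M + 3)))).toSphere) with hσ
  have hex : ∀ n : ℕ, ∃ p : Polynomial ℝ, ∀ x ∈ Set.Icc (-1 : ℝ) 1,
      |p.eval x - h x| < 1 / ((n : ℝ) + 1) := fun n =>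
    exists_polynomial_near_of_continuousOn (-1) 1 h hc.continuousOn _ (by positivity)
  choose p hp using hex
  have hlim : ∀ x ∈ Set.Icc (-1 : ℝ) 1,
      Filter.Tendsto (fun n => (p n).eval x) Filter.atTop (nhds (h x)) := by
    intro x hx
    rw [tendsto_iff_dist_tendsto_zero]
    refine squeeze_zero (fun _ => dist_nonneg) (fun n => ?_)
      (tendsto_one_div_add_atTop_nhds_zero_nat (𝕜 := ℝ))
    rw [Real.dist_eq]
    exact (hp n x hx).le
  obtain ⟨B, hB⟩ := (isCompact_Icc (a := (-1:ℝ)) (b := 1)).exists_bound_of_continuousOn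
    hc.continuousOn
  have hbd : ∀ n, ∀ x ∈ Set.Icc (-1 : ℝ) 1, ‖(p n).eval x‖ ≤ B + 1 := by
    intro n x hx
    have h1 := hp n x hx
    have h2 := hB x hx
    have h3 : 1 / ((n : ℝ) + 1) ≤ 1 := by
      rw [div_le_one (by positivity)]
      have : (0:ℝ) ≤ n := Nat.cast_nonneg n
      linarith
    rw [Real.norm_eq_abs] at *
    have h4 := abs_add_le ((p n).eval x - h x) (h x)
    rw [sub_add_cancel] at h4
    linarith
  have hL := tendsto_integral_of_dominated_convergence (μ := σ)
    (F := fun n w' => (p n).eval ⟪(w : EuclideanSpace ℝ (Fin (M + 3))),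
      ((w' : Metric.sphere (0 : EuclideanSpace ℝ (Fin (M + 3))) 1) :
        EuclideanSpace ℝ (Fin (M + 3)))⟫ *
            MvPolynomial.eval (fun i => (w' : EuclideanSpace ℝ (Fin (M + 3))) i) P)
    (f := fun w' => h ⟪(w : EuclideanSpace ℝ (Fin (M + 3))), (w' : EuclideanSpace ℝ (Fin (M + 3)))⟫ *
            MvPolynomial.eval (fun i => (w' : EuclideanSpace ℝ (Fin (M + 3))) i) P)
    (fun w' => (B + 1) * ‖MvPolynomial.eval (fun i => (w' : EuclideanSpace ℝ (Fin (M + 3))) i) P‖)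
    (fun n => (sphere_integrable (((p n).continuous.comp (by fun_prop)).mul
      (continuous_eval_sphere P))).aestronglyMeasurable)
    ((sphere_integrable (continuous_eval_sphere P).norm).const_mul _)
    (fun n => Filter.Eventually.of_forall fun w' => by
      rw [norm_mul]
      exact mul_le_mul_of_nonneg_right (hbd n _ (inner_mem w w')) (norm_nonneg _))
    (Filter.Eventually.of_forall fun w' => (hlim _ (inner_mem w w')).mul_const _)
  have hcos : ∀ t, Real.cos t ∈ Set.Icc (-1 : ℝ) 1 := fun t =>
    ⟨Real.neg_one_le_cos t, Real.cos_le_one t⟩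
  have hR := intervalIntegral.tendsto_integral_filter_of_dominated_convergence
    (μ := volume) (a := 0) (b := Real.pi) (l := Filter.atTop)
    (F := fun n t => (p n).eval (Real.cos t) *
        (rodQ ((M + 2 * l : ℕ) : ℝ) l).eval (Real.cos t) * Real.sin t ^ (M + 1))
    (f := fun t => h (Real.cos t) *
        (rodQ ((M + 2 * l : ℕ) : ℝ) l).eval (Real.cos t) * Real.sin t ^ (M + 1))
    (fun t => (B + 1) * ‖(rodQ ((M + 2 * l : ℕ) : ℝ) l).eval (Real.cos t) * Real.sin t ^ (M + 1)‖)
    (Filter.Eventually.of_forall fun n => Continuous.aestronglyMeasurable (by fun_prop))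
    (Filter.Eventually.of_forall fun n => Filter.Eventually.of_forall fun t _ => by
      rw [mul_assoc, norm_mul]
      exact mul_le_mul_of_nonneg_right (hbd n _ (hcos t)) (norm_nonneg _))
    (Continuous.intervalIntegrable (by fun_prop) _ _)
    (Filter.Eventually.of_forall fun t _ => by
      exact ((hlim _ (hcos t)).mul_const _).mul_const _)
  have hR2 := (hR.const_mul (kap M l)).mul_const
    (MvPolynomial.eval (fun i => (w : EuclideanSpace ℝ (Fin (M + 3))) i) P)
  refine tendsto_nhds_unique hL (hR2.congr fun n => ?_)
  exact (poly_case M l P hharm hP w (p n)).symm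

/-- Funk–Hecke type formula: for `h` continuous on `[-1,1]` and `p` a harmonic
polynomial on `ℝ^m` homogeneous of degree `l`,
`∫_{S^{m-1}} h(⟨ω,ω'⟩) p(ω') dω' = c_{l,m}(h) p(ω)`, where `dω'` is the surface
measure on the unit sphere. -/
theorem funk_hecke (m l : ℕ) (hm : 3 ≤ m) (h : ℝ → ℝ)
    (hcont : ContinuousOn h (Set.Icc (-1) 1))
    (P : MvPolynomial (Fin m) ℝ)
    (hharm : ∑ j, MvPolynomial.pderiv j (MvPolynomial.pderiv j P) = 0)
    (hhom : ∀ lam : ℝ, 0 < lam → ∀ x : EuclideanSpace ℝ (Fin m),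
      MvPolynomial.eval (fun i => lam * x i) P =
        lam ^ l * MvPolynomial.eval (fun i => x i) P) :
    ∀ ω : Metric.sphere (0 : EuclideanSpace ℝ (Fin m)) 1,
      ∫ ω' : Metric.sphere (0 : EuclideanSpace ℝ (Fin m)) 1,
          h ⟪(ω : EuclideanSpace ℝ (Fin m)), (ω' : EuclideanSpace ℝ (Fin m))⟫ *
            MvPolynomial.eval (fun i => (ω' : EuclideanSpace ℝ (Fin m)) i) P
          ∂((volume : Measure (EuclideanSpace ℝ (Fin m))).toSphere) =
        funkHeckeCoeff m l h *
          MvPolynomial.eval (fun i => (ω : EuclideanSpace ℝ (Fin m)) i) P := by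
  obtain ⟨M, rfl⟩ : ∃ M, m = M + 3 := ⟨m - 3, by omega⟩
  intro ω
  have hP := hom_of_scale P hhom
  set H : ℝ → ℝ := Set.IccExtend (by norm_num : (-1 : ℝ) ≤ 1) ((Set.Icc (-1 : ℝ) 1).domRestrict h)
    with hH
  have hHc : Continuous H := Continuous.Icc_extend' hcont.domRestrict
  have hHe : ∀ x ∈ Set.Icc (-1 : ℝ) 1, H x = h x := by
    intro x hx
    rw [hH, Set.IccExtend_of_mem _ _ hx]
    rfl
  have key := cont_case M l P hharm hP ω H hHc
  rw [coeff_eq]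
  have hcos : ∀ t, Real.cos t ∈ Set.Icc (-1 : ℝ) 1 := fun t =>
    ⟨Real.neg_one_le_cos t, Real.cos_le_one t⟩
  simp only [fun t => hHe _ (hcos t), fun w' => hHe _ (inner_mem ω w')] at key
  exact key
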